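/- Suppose Σ is linear, S_xu and D are convex and compact, the origin is a forced equilibrium of 𝒟(Σ) in the interior of S_xu × D with 0 ∈ π_n(C_{max,p_0}), and 𝒟(Σ) is controllable. Then d_p = d_H(π_n(C_{max,p}), C_{max,co}) → 0 as p → ∞, and for all p ≥ p_0, d_p ≤ (1 − λ_0)(1 − γ_max)^{⌊(p−p_0)/N⌋} r_co, where N ≥ n, γ_max is the maximal γ such that γ C_{max,co} ⊆ Pre^N_{𝒟(Σ)}({0}, S_xu × D), λ_0 is the maximal λ with λ C_{max,co} ⊆ π_n(C_{max,p_0}), and r_co is the radius of the smallest ball centered at 0 containing C_{max,co}. -/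

import Mathlib

open Set Pointwise

section Defs

variable {X U W : Type*}

/-- Robust controlled invariant set of `x⁺ = f x u d` (disturbance `d ∈ D`) in safe set `S`. -/
def IsRCIS (f : X → U → W → X) (D : Set W) (S : Set (X × U)) (C : Set X) : Prop :=
  ∀ x ∈ C, ∃ u, (x, u) ∈ S ∧ ∀ d ∈ D, f x u d ∈ C

/-- Maximal RCIS: an RCIS containing every RCIS. -/
def IsMaxRCIS (f : X → U → W → X) (D : Set W) (S : Set (X × U)) (C : Set X) : Prop :=
  IsRCIS f D S C ∧ ∀ C', IsRCIS f D S C' → C' ⊆ C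

/-- Controlled invariant set of the disturbance-free system `x⁺ = g x u` in safe set `S`. -/
def IsCIS (g : X → U → X) (S : Set (X × U)) (C : Set X) : Prop :=
  ∀ x ∈ C, ∃ u, (x, u) ∈ S ∧ g x u ∈ C

/-- Maximal CIS. -/
def IsMaxCIS (g : X → U → X) (S : Set (X × U)) (C : Set X) : Prop :=
  IsCIS g S C ∧ ∀ C', IsCIS g S C' → C' ⊆ C

/-- One-step backward reachable set for a disturbance-free system. -/
def pre (g : X → U → X) (S : Set (X × U)) (T : Set X) : Set X :=
  {x | ∃ u, (x, u) ∈ S ∧ g x u ∈ T}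

/-- `k`-step backward reachable set for a disturbance-free system. -/
def preN (g : X → U → X) (S : Set (X × U)) : ℕ → Set X → Set X
  | 0, T => T
  | k + 1, T => pre g S (preN g S k T)

/-- One-step robust backward reachable set for a system with disturbance `d ∈ D`. -/
def preR (f : X → U → W → X) (D : Set W) (S : Set (X × U)) (T : Set X) : Set X :=
  {x | ∃ u, (x, u) ∈ S ∧ ∀ d ∈ D, f x u d ∈ T}

/-- `k`-step robust backward reachable set. -/
def preRN (f : X → U → W → X) (D : Set W) (S : Set (X × U)) : ℕ → Set X → Set X
  | 0, T => T
  | k + 1, T => preR f D S (preRN f D S k T)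

/-- Dynamics of the `p`-augmented system `Σ_p`: state `(x, d_{1:p})`,
`x⁺ = f x u d₁`, `dᵢ⁺ = d_{i+1}`, `d_p⁺ = d` (new disturbance). -/
def augDyn (f : X → U → W → X) (p : ℕ) :
    X × (Fin p → W) → U → W → X × (Fin p → W) :=
  fun s u dnew =>
    (f s.1 u (if h : 0 < p then s.2 ⟨0, h⟩ else dnew),
     fun i => if h : (i : ℕ) + 1 < p then s.2 ⟨(i : ℕ) + 1, h⟩ else dnew)

/-- Safe set `S_{xu,p}` of the `p`-augmented system. -/
def augSafe (S : Set (X × U)) (D : Set W) (p : ℕ) :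
    Set ((X × (Fin p → W)) × U) :=
  {s | (s.1.1, s.2) ∈ S ∧ ∀ i, s.1.2 i ∈ D}

/-- Dynamics of the disturbance collaborative system `𝒟(Σ)`:
the disturbance becomes a second control input. -/
def dcDyn (f : X → U → W → X) : X → U × W → X := fun x v => f x v.1 v.2

/-- Safe set `S_xu × D` of the disturbance collaborative system. -/
def dcSafe (S : Set (X × U)) (D : Set W) : Set (X × (U × W)) :=
  {s | (s.1, s.2.1) ∈ S ∧ s.2.2 ∈ D}

/-- The set `C × D^{p-p'}` viewed inside the state space of `Σ_p`, for `p' ≤ p`. -/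
def liftSet {p' p : ℕ} (h : p' ≤ p) (C : Set (X × (Fin p' → W))) (D : Set W) :
    Set (X × (Fin p → W)) :=
  {s | (s.1, fun i : Fin p' => s.2 (Fin.castLE h i)) ∈ C ∧
    ∀ i : Fin p, p' ≤ (i : ℕ) → s.2 i ∈ D}

/-- The set `C × D^p` viewed inside the state space of `Σ_p`, for `C ⊆ X`. -/
def prodD (C : Set X) (D : Set W) (p : ℕ) : Set (X × (Fin p → W)) :=
  {s | s.1 ∈ C ∧ ∀ i : Fin p, s.2 i ∈ D}

/-- The feasible domain `ℱ_p(C)` of the preview MPC with prediction horizon `p`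
and terminal constraint set `C`. -/
def feasDom (f : X → U → W → X) (D : Set W) (S : Set (X × U)) (C : Set X) (p : ℕ) :
    Set (X × (Fin p → W)) :=
  {s | (∀ i, s.2 i ∈ D) ∧
    ∃ xs : Fin (p + 1) → X, ∃ us : Fin p → U,
      xs 0 = s.1 ∧
      (∀ t : Fin p, xs t.succ = f (xs t.castSucc) (us t) (s.2 t) ∧
        (xs t.castSucc, us t) ∈ S) ∧
      xs (Fin.last p) ∈ C}

end Defs

/-- Linear dynamics `x⁺ = A x + B u + E d` on plain vector spaces `Fin n → ℝ`. -/
def linDyn {n m l : ℕ} (A : Matrix (Fin n) (Fin n) ℝ) (B : Matrix (Fin n) (Fin m) ℝ)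
    (E : Matrix (Fin n) (Fin l) ℝ) :
    (Fin n → ℝ) → (Fin m → ℝ) → (Fin l → ℝ) → (Fin n → ℝ) :=
  fun x u d => A.mulVec x + B.mulVec u + E.mulVec d

/-- Linear dynamics `x⁺ = A x + B u + E d` on Euclidean spaces. -/
noncomputable def linDynE {n m l : ℕ} (A : Matrix (Fin n) (Fin n) ℝ)
    (B : Matrix (Fin n) (Fin m) ℝ) (E : Matrix (Fin n) (Fin l) ℝ) :
    EuclideanSpace ℝ (Fin n) → EuclideanSpace ℝ (Fin m) → EuclideanSpace ℝ (Fin l) →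
      EuclideanSpace ℝ (Fin n) :=
  fun x u d => (EuclideanSpace.equiv (Fin n) ℝ).symm
    (A.mulVec (EuclideanSpace.equiv (Fin n) ℝ x) + B.mulVec (EuclideanSpace.equiv (Fin m) ℝ u)
      + E.mulVec (EuclideanSpace.equiv (Fin l) ℝ d))

section Invariance

variable {X U W : Type*}

theorem subset_preN_of_isCIS {g : X → U → X} {S : Set (X × U)} {C : Set X}
    (hC : IsCIS g S C) (k : ℕ) : C ⊆ preN g S k C := by
  induction k with
  | zero => exact Subset.rfl
  | succ k ih =>
    intro x hx
    obtain ⟨u, hu, hxu⟩ := hC x hx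
    exact ⟨u, hu, ih hxu⟩

theorem isCIS_preN {g : X → U → X} {S : Set (X × U)} {T : Set X}
    (hT : IsCIS g S T) (k : ℕ) : IsCIS g S (preN g S k T) := by
  induction k with
  | zero => exact hT
  | succ k ih =>
    rintro x ⟨u, hu, hxu⟩
    obtain ⟨v, hv, hxv⟩ := ih _ hxu
    exact ⟨u, hu, v, hv, hxv⟩

theorem isCIS_fst_image_of_isRCIS {f : X → U → W → X} {D : Set W} {S : Set (X × U)} {p : ℕ}
    {C : Set (X × (Fin p → W))} (hD : D.Nonempty)
    (hC : IsRCIS (augDyn f p) D (augSafe S D p) C) :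
    IsCIS (dcDyn f) (dcSafe S D) (Prod.fst '' C) := by
  rintro _ ⟨⟨x, d⟩, hs, rfl⟩
  obtain ⟨u, ⟨hu, hd⟩, hnext⟩ := hC _ hs
  obtain ⟨d', hd'⟩ := hD
  refine ⟨(u, if h : 0 < p then d ⟨0, h⟩ else d'), ⟨hu, ?_⟩, _, hnext d' hd', rfl⟩
  by_cases h : 0 < p
  · simpa [h] using hd ⟨0, h⟩
  · simpa [h] using hd'

/-- One step of foreseen disturbance in front of an RCIS of `Σ_p` gives an RCIS of `Σ_{p+1}`. -/
theorem isRCIS_augDyn_succ {f : X → U → W → X} {D : Set W} {S : Set (X × U)} {p : ℕ}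
    {C : Set (X × (Fin p → W))} (hC : IsRCIS (augDyn f p) D (augSafe S D p) C) :
    IsRCIS (augDyn f (p + 1)) D (augSafe S D (p + 1))
      {s | (∀ i, s.2 i ∈ D) ∧ ∃ u, (s.1, u) ∈ S ∧ (f s.1 u (s.2 0), Fin.tail s.2) ∈ C} := by
  rintro ⟨x, d⟩ ⟨hd, u, hu, hxu⟩
  refine ⟨u, ⟨hu, hd⟩, fun d' hd' => ⟨fun i => ?_, ?_⟩⟩
  · dsimp only [augDyn]
    split_ifs with h
    exacts [hd _, hd']
  · obtain ⟨v, ⟨hv, -⟩, hnext⟩ := hC _ hxu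
    refine ⟨v, by simpa [augDyn] using hv, ?_⟩
    convert hnext d' hd' using 1
    refine Prod.ext ?_ (funext fun i => ?_)
    · by_cases h : 0 < p <;> simp [augDyn, h, Fin.tail]
    · by_cases h : (i : ℕ) + 1 < p <;> simp [augDyn, h, Fin.tail]

theorem pre_fst_image_subset {f : X → U → W → X} {D : Set W} {S : Set (X × U)} {p : ℕ}
    {C : Set (X × (Fin p → W))} {C' : Set (X × (Fin (p + 1) → W))}
    (hC : IsRCIS (augDyn f p) D (augSafe S D p) C)
    (hC' : IsMaxRCIS (augDyn f (p + 1)) D (augSafe S D (p + 1)) C') :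
    pre (dcDyn f) (dcSafe S D) (Prod.fst '' C) ⊆ Prod.fst '' C' := by
  rintro x ⟨⟨u, d⟩, ⟨hu, hd⟩, ⟨y, e⟩, hs, hy⟩
  obtain rfl : y = f x u d := hy
  have he : ∀ i, e i ∈ D := (hC _ hs).choose_spec.1.2
  refine ⟨(x, Fin.cons d e), hC'.2 _ (isRCIS_augDyn_succ hC) ⟨?_, u, hu, ?_⟩, rfl⟩
  · intro i
    refine Fin.cases ?_ (fun j => ?_) i
    · simpa using hd
    · simpa using he j
  · simpa using hs

theorem preN_succ' (g : X → U → X) (S : Set (X × U)) (k : ℕ) (T : Set X) :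
    preN g S (k + 1) T = preN g S k (pre g S T) := by
  induction k with
  | zero => rfl
  | succ k ih => exact congrArg (pre g S) ih

theorem preN_mono (g : X → U → X) (S : Set (X × U)) (k : ℕ) {T T' : Set X} (h : T ⊆ T') :
    preN g S k T ⊆ preN g S k T' := by
  induction k with
  | zero => exact h
  | succ k ih => exact fun x ⟨u, hu, hxu⟩ => ⟨u, hu, ih hxu⟩

theorem preN_fst_image_subset {f : X → U → W → X} {D : Set W} {S : Set (X × U)}
    {C : (q : ℕ) → Set (X × (Fin q → W))}
    (hC : ∀ q, IsMaxRCIS (augDyn f q) D (augSafe S D q) (C q)) (p k : ℕ) :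
    preN (dcDyn f) (dcSafe S D) k (Prod.fst '' C p) ⊆ Prod.fst '' C (p + k) := by
  induction k generalizing p with
  | zero => exact Subset.rfl
  | succ k ih =>
    rw [preN_succ', Nat.add_comm k 1, ← Nat.add_assoc]
    exact (preN_mono _ _ _ (pre_fst_image_subset (hC p).1 (hC (p + 1)))).trans (ih (p + 1))

theorem monotone_fst_image {f : X → U → W → X} {D : Set W} {S : Set (X × U)}
    {C : (q : ℕ) → Set (X × (Fin q → W))} (hD : D.Nonempty)
    (hC : ∀ q, IsMaxRCIS (augDyn f q) D (augSafe S D q) (C q)) :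
    Monotone fun q => Prod.fst '' C q :=
  monotone_nat_of_le_succ fun q =>
    (subset_preN_of_isCIS (isCIS_fst_image_of_isRCIS hD (hC q).1) 1).trans
      (preN_fst_image_subset hC q 1)

end Invariance

section Scaling

variable {V : Type*} [NormedAddCommGroup V] [NormedSpace ℝ V]

theorem isGreatest_smul_subset_nonneg {C T : Set V} {c : ℝ} (h0 : (0 : V) ∈ T)
    (hc : IsGreatest {t : ℝ | t • C ⊆ T} c) : 0 ≤ c := by
  refine hc.2 ?_
  rintro _ ⟨x, -, rfl⟩
  simpa using h0

theorem isGreatest_smul_subset_le_one {C T : Set V} {c r : ℝ} (h0 : (0 : V) ∈ T) (hTC : T ⊆ C)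
    (hc : IsGreatest {t : ℝ | t • C ⊆ T} c)
    (hr : IsLeast {r : ℝ | 0 ≤ r ∧ C ⊆ Metric.closedBall 0 r} r) : c ≤ 1 := by
  by_contra! h
  have hc0 : 0 < c := by linarith
  have hle : r ≤ r / c := by
    refine hr.2 ⟨div_nonneg hr.1.1 hc0.le, fun x hx => ?_⟩
    have := hr.1.2 (hTC (hc.1 (smul_mem_smul_set hx)))
    rw [mem_closedBall_zero_iff, norm_smul, Real.norm_of_nonneg hc0.le] at this
    rw [mem_closedBall_zero_iff, le_div_iff₀ hc0]
    linarith
  rw [le_div_iff₀ hc0] at hle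
  have hr0 : r = 0 := by nlinarith [hr.1.1]
  have : c + 1 ≤ c := hc.2 <| by
    rintro _ ⟨x, hx, rfl⟩
    have := hr.1.2 hx
    rw [hr0, mem_closedBall_zero_iff, norm_le_zero_iff] at this
    simpa [this] using h0
  linarith

theorem hausdorffDist_le_of_smul_subset {C T : Set V} {c r : ℝ} (hc : c ≤ 1) (hr : 0 ≤ r)
    (hC : C ⊆ Metric.closedBall 0 r) (hTC : T ⊆ C) (hcC : c • C ⊆ T) :
    Metric.hausdorffDist T C ≤ (1 - c) * r := by
  have hnn : 0 ≤ (1 - c) * r := mul_nonneg (by linarith) hr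
  refine Metric.hausdorffDist_le_of_mem_dist hnn
    (fun x hx => ⟨x, hTC hx, by simpa using hnn⟩)
    (fun x hx => ⟨c • x, hcC (smul_mem_smul_set hx), ?_⟩)
  have : x - c • x = (1 - c) • x := by module
  rw [dist_eq_norm, this, norm_smul, Real.norm_of_nonneg (by linarith)]
  exact mul_le_mul_of_nonneg_left (mem_closedBall_zero_iff.1 (hC hx)) (by linarith)

/-- In finite dimension, a convex set that absorbs every vector contains a ball around `0`. -/
theorem Convex.exists_closedBall_subset_of_absorbs {n : ℕ} {K : Set (EuclideanSpace ℝ (Fin n))}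
    (hK : Convex ℝ K) (h : ∀ x, ∃ t : ℝ, 0 < t ∧ t • x ∈ K) :
    ∃ r : ℝ, 0 < r ∧ Metric.closedBall 0 r ⊆ K := by
  have h0 : (0 : EuclideanSpace ℝ (Fin n)) ∈ K := by
    obtain ⟨t, -, ht⟩ := h 0
    simpa using ht
  rcases Nat.eq_zero_or_pos n with rfl | hn
  · exact ⟨1, one_pos, fun x _ => by rwa [Subsingleton.elim x 0]⟩
  have hcoord : ∀ i : Fin n, ∃ t : ℝ, 0 < t ∧ ∀ c : ℝ, |c| ≤ t →
      c • EuclideanSpace.single i (1 : ℝ) ∈ K := by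
    intro i
    obtain ⟨s, hs, hsK⟩ := h (EuclideanSpace.single i 1)
    obtain ⟨t, ht, htK⟩ := h (-EuclideanSpace.single i 1)
    refine ⟨min s t, lt_min hs ht, fun c hc => ?_⟩
    rcases le_total 0 c with hc0 | hc0
    · rw [abs_of_nonneg hc0] at hc
      have := hK.smul_mem_of_zero_mem h0 hsK (t := c / s)
        ⟨by positivity, (div_le_one hs).2 (hc.trans (min_le_left _ _))⟩
      rwa [smul_smul, div_mul_cancel₀ _ hs.ne'] at this
    · rw [abs_of_nonpos hc0] at hc
      have := hK.smul_mem_of_zero_mem h0 htK (t := -c / t)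
        ⟨div_nonneg (by linarith) ht.le, (div_le_one ht).2 (hc.trans (min_le_right _ _))⟩
      rwa [smul_smul, div_mul_cancel₀ _ ht.ne', smul_neg, neg_smul, neg_neg] at this
  choose t ht htK using hcoord
  have : Nonempty (Fin n) := ⟨⟨0, hn⟩⟩
  obtain ⟨j, hj⟩ := Finite.exists_min t
  have hn' : (0 : ℝ) < n := by exact_mod_cast hn
  refine ⟨t j / n, div_pos (ht j) hn', fun x hx => ?_⟩
  rw [mem_closedBall_zero_iff, le_div_iff₀ hn'] at hx
  have hsum : x = ∑ i : Fin n, (1 / n : ℝ) • ((n * x i) • EuclideanSpace.single i (1 : ℝ)) := by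
    ext k
    simp [Pi.single_apply, hn'.ne']
  rw [hsum]
  refine hK.sum_mem (fun _ _ => by positivity) (by simp [hn'.ne']) fun i _ => htK i _ ?_
  have := PiLp.norm_apply_le x i
  rw [Real.norm_eq_abs] at this
  rw [abs_mul, abs_of_pos hn']
  nlinarith [hj i]

end Scaling

section Linear

variable {n m l : ℕ} {A : Matrix (Fin n) (Fin n) ℝ} {B : Matrix (Fin n) (Fin m) ℝ}
  {E : Matrix (Fin n) (Fin l) ℝ}

theorem linDynE_add_smul (a b : ℝ) (x y : EuclideanSpace ℝ (Fin n))
    (u v : EuclideanSpace ℝ (Fin m)) (d e : EuclideanSpace ℝ (Fin l)) :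
    linDynE A B E (a • x + b • y) (a • u + b • v) (a • d + b • e) =
      a • linDynE A B E x u d + b • linDynE A B E y v e := by
  simp only [linDynE, map_add, map_smul, Matrix.mulVec_add, Matrix.mulVec_smul]
  module

theorem linDynE_smul (a : ℝ) (x : EuclideanSpace ℝ (Fin n))
    (u : EuclideanSpace ℝ (Fin m)) (d : EuclideanSpace ℝ (Fin l)) :
    linDynE A B E (a • x) (a • u) (a • d) = a • linDynE A B E x u d := by
  simpa using linDynE_add_smul (A := A) (B := B) (E := E) a 0 x 0 u 0 d 0

theorem linDynE_zero : linDynE A B E 0 0 0 = 0 := by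
  simpa using linDynE_smul (A := A) (B := B) (E := E) 0 0 0 0

variable {S : Set (EuclideanSpace ℝ (Fin n) × EuclideanSpace ℝ (Fin m))}
  {D : Set (EuclideanSpace ℝ (Fin l))}

theorem preN_dcDyn_add_smul (hS : Convex ℝ S) (hD : Convex ℝ D)
    {P Q R : Set (EuclideanSpace ℝ (Fin n))} {a b : ℝ} (ha : 0 ≤ a) (hb : 0 ≤ b)
    (hab : a + b = 1) (hR : ∀ x ∈ P, ∀ y ∈ Q, a • x + b • y ∈ R) (k : ℕ) :
    ∀ x ∈ preN (dcDyn (linDynE A B E)) (dcSafe S D) k P,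
      ∀ y ∈ preN (dcDyn (linDynE A B E)) (dcSafe S D) k Q,
        a • x + b • y ∈ preN (dcDyn (linDynE A B E)) (dcSafe S D) k R := by
  induction k with
  | zero => exact hR
  | succ k ih =>
    rintro x ⟨⟨u, d⟩, ⟨hu, hd⟩, hx⟩ y ⟨⟨v, e⟩, ⟨hv, he⟩, hy⟩
    refine ⟨(a • u + b • v, a • d + b • e), ⟨hS hu hv ha hb hab, hD hd he ha hb hab⟩, ?_⟩
    have := ih _ hx _ hy
    simpa only [dcDyn, linDynE_add_smul] using this

theorem convex_preN_zero (hS : Convex ℝ S) (hD : Convex ℝ D) (k : ℕ) :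
    Convex ℝ (preN (dcDyn (linDynE A B E)) (dcSafe S D) k {0}) :=
  fun x hx y hy _ _ ha hb hab => preN_dcDyn_add_smul hS hD ha hb hab (by simp) k x hx y hy

theorem isCIS_zero (h0 : (0, (0, 0)) ∈ dcSafe S D) :
    IsCIS (dcDyn (linDynE A B E)) (dcSafe S D) {0} := by
  rintro _ rfl
  exact ⟨0, h0, linDynE_zero⟩

/-- If `0` is interior to the safe set, a point that can be steered to `0` in `k` steps without
constraints can be scaled down so that it can be steered safely. -/
theorem exists_smul_mem_preN_zero (hS : Convex ℝ S) (hD : Convex ℝ D)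
    (h0 : (0, (0, 0)) ∈ interior (dcSafe S D)) (k : ℕ) (x : EuclideanSpace ℝ (Fin n))
    (hx : x ∈ preN (dcDyn (linDynE A B E)) univ k {0}) :
    ∃ t : ℝ, 0 < t ∧ t • x ∈ preN (dcDyn (linDynE A B E)) (dcSafe S D) k {0} := by
  induction k generalizing x with
  | zero => exact ⟨1, one_pos, by rwa [one_smul]⟩
  | succ k ih =>
    obtain ⟨⟨u, d⟩, -, hxu⟩ := hx
    obtain ⟨t, ht, htk⟩ := ih _ hxu
    have hcont : Filter.Tendsto (fun s : ℝ => (s • x, (s • u, s • d))) (nhdsWithin 0 (Ioi 0))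
        (nhds (0, (0, 0))) := by
      have : Continuous fun s : ℝ => (s • x, (s • u, s • d)) := by fun_prop
      simpa using (this.tendsto 0).mono_left nhdsWithin_le_nhds
    obtain ⟨s, hs, hs0, hst⟩ := ((hcont.eventually_mem (mem_interior_iff_mem_nhds.1 h0)).and
      (Filter.eventually_mem_set.2 (Ioo_mem_nhdsGT ht))).exists
    refine ⟨s, hs0, (s • u, s • d), hs, ?_⟩
    have hzero := subset_preN_of_isCIS
      (isCIS_zero (A := A) (B := B) (E := E) (interior_subset h0)) k rfl
    have := (convex_preN_zero hS hD k).smul_mem_of_zero_mem hzero htk (t := s / t)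
      ⟨by positivity, (div_le_one ht).2 hst.le⟩
    rw [smul_smul, div_mul_cancel₀ _ ht.ne'] at this
    simpa only [dcDyn, linDynE_smul] using this

/-- The subspace reachable from `0` in `k` steps by the system with inputs through `B` and `E`. -/
def reachSpan (A : Matrix (Fin n) (Fin n) ℝ) (B : Matrix (Fin n) (Fin m) ℝ)
    (E : Matrix (Fin n) (Fin l) ℝ) (k : ℕ) : Submodule ℝ (Fin n → ℝ) :=
  Submodule.span ℝ {v | ∃ i : ℕ, i < k ∧ ∃ (w : Fin m → ℝ) (z : Fin l → ℝ),
    v = (A ^ i).mulVec (B.mulVec w + E.mulVec z)}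

theorem exists_sub_mem_reachSpan {k : ℕ} {y : Fin n → ℝ} (hy : y ∈ reachSpan A B E (k + 1)) :
    ∃ (w : Fin m → ℝ) (z : Fin l → ℝ),
      y - (A ^ k).mulVec (B.mulVec w + E.mulVec z) ∈ reachSpan A B E k := by
  induction hy using Submodule.span_induction with
  | mem y hy =>
    obtain ⟨i, hi, w, z, rfl⟩ := hy
    rcases Nat.lt_succ_iff_lt_or_eq.1 hi with hi | rfl
    · refine ⟨0, 0, ?_⟩
      rw [Matrix.mulVec_zero, Matrix.mulVec_zero, add_zero, Matrix.mulVec_zero, sub_zero]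
      exact Submodule.subset_span ⟨i, hi, w, z, rfl⟩
    · exact ⟨w, z, by simp⟩
  | zero => exact ⟨0, 0, by simp⟩
  | add y y' _ _ h h' =>
    obtain ⟨w, z, h⟩ := h
    obtain ⟨w', z', h'⟩ := h'
    refine ⟨w + w', z + z', ?_⟩
    convert add_mem h h' using 1
    simp only [Matrix.mulVec_add]
    abel
  | smul c y _ h =>
    obtain ⟨w, z, h⟩ := h
    refine ⟨c • w, c • z, ?_⟩
    convert Submodule.smul_mem _ c h using 1
    simp only [Matrix.mulVec_add, Matrix.mulVec_smul, smul_sub, smul_add]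

theorem mem_preN_univ_zero (k : ℕ) (x : EuclideanSpace ℝ (Fin n))
    (hx : (A ^ k).mulVec (EuclideanSpace.equiv (Fin n) ℝ x) ∈ reachSpan A B E k) :
    x ∈ preN (dcDyn (linDynE A B E)) univ k {0} := by
  induction k generalizing x with
  | zero =>
    rw [preN, mem_singleton_iff]
    simpa [reachSpan] using hx
  | succ k ih =>
    obtain ⟨w, z, h⟩ := exists_sub_mem_reachSpan hx
    refine ⟨((EuclideanSpace.equiv (Fin m) ℝ).symm (-w),
      (EuclideanSpace.equiv (Fin l) ℝ).symm (-z)), mem_univ _, ih _ ?_⟩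
    convert h using 1
    simp only [dcDyn, linDynE, ContinuousLinearEquiv.apply_symm_apply, Matrix.mulVec_add,
      Matrix.mulVec_neg, Matrix.mulVec_mulVec, pow_succ]
    abel

end Linear

/-- **Corollary (exponential decay of the safety regret under controllability).**
If `𝒟(Σ)` is controllable, then `d_p = d_H(π_n(C_{max,p}), C_{max,co}) → 0` as
`p → ∞`, and for every `p ≥ p₀`,
`d_p ≤ (1-λ₀)(1-γ_max)^{⌊(p-p₀)/N⌋} r_co`. -/
theorem safety_regret_decay_controllable {n m l : ℕ}
    (A : Matrix (Fin n) (Fin n) ℝ) (B : Matrix (Fin n) (Fin m) ℝ)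
    (E : Matrix (Fin n) (Fin l) ℝ)
    (hctrb : Submodule.span ℝ
      {v : Fin n → ℝ | ∃ k : ℕ, k < n ∧ ∃ (w : Fin m → ℝ) (z : Fin l → ℝ),
        v = (A ^ k).mulVec (B.mulVec w + E.mulVec z)} = ⊤)
    (D : Set (EuclideanSpace ℝ (Fin l)))
    (S : Set (EuclideanSpace ℝ (Fin n) × EuclideanSpace ℝ (Fin m)))
    (hDconv : Convex ℝ D) (hDcpt : IsCompact D)
    (hSconv : Convex ℝ S) (hScpt : IsCompact S)
    (h0int : ((0 : EuclideanSpace ℝ (Fin n)),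
      ((0 : EuclideanSpace ℝ (Fin m)), (0 : EuclideanSpace ℝ (Fin l)))) ∈
      interior (dcSafe S D))
    (Cfam : (q : ℕ) → Set (EuclideanSpace ℝ (Fin n) × (Fin q → EuclideanSpace ℝ (Fin l))))
    (hCfam : ∀ q : ℕ, IsMaxRCIS (augDyn (linDynE A B E) q) D (augSafe S D q) (Cfam q))
    (p₀ : ℕ) (h0proj : (0 : EuclideanSpace ℝ (Fin n)) ∈ Prod.fst '' (Cfam p₀))
    (Cco : Set (EuclideanSpace ℝ (Fin n)))
    (hCco : IsMaxCIS (dcDyn (linDynE A B E)) (dcSafe S D) Cco)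
    (N : ℕ) (hN : n ≤ N)
    (γmax : ℝ)
    (hγmax : IsGreatest {γ : ℝ |
      γ • Cco ⊆ preN (dcDyn (linDynE A B E)) (dcSafe S D) N {0}} γmax)
    (lam0 : ℝ)
    (hlam0 : IsGreatest {t : ℝ | t • Cco ⊆ Prod.fst '' (Cfam p₀)} lam0)
    (rco : ℝ)
    (hrco : IsLeast {r : ℝ | 0 ≤ r ∧ Cco ⊆ Metric.closedBall 0 r} rco) :
    Filter.Tendsto (fun p : ℕ => Metric.hausdorffDist (Prod.fst '' (Cfam p)) Cco)
      Filter.atTop (nhds 0) ∧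
    ∀ p : ℕ, p₀ ≤ p →
      Metric.hausdorffDist (Prod.fst '' (Cfam p)) Cco ≤
        (1 - lam0) * (1 - γmax) ^ ((p - p₀) / N) * rco := by
  have h0safe := interior_subset h0int
  have hD : D.Nonempty := ⟨0, h0safe.2⟩
  have h0N : (0 : EuclideanSpace ℝ (Fin n)) ∈
      preN (dcDyn (linDynE A B E)) (dcSafe S D) N {0} :=
    subset_preN_of_isCIS (isCIS_zero h0safe) N rfl
  have hNco : preN (dcDyn (linDynE A B E)) (dcSafe S D) N {0} ⊆ Cco :=
    hCco.2 _ (isCIS_preN (isCIS_zero h0safe) N)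
  have hproj : ∀ p, Prod.fst '' Cfam p ⊆ Cco := fun p =>
    hCco.2 _ (isCIS_fst_image_of_isRCIS hD (hCfam p).1)
  have hmono := monotone_fst_image hD hCfam
  have hlam_nonneg := isGreatest_smul_subset_nonneg h0proj hlam0
  have hlam_le := isGreatest_smul_subset_le_one h0proj (hproj p₀) hlam0 hrco
  have hγ_le := isGreatest_smul_subset_le_one h0N hNco hγmax hrco
  have hN0 : 0 < N := by
    refine Nat.pos_of_ne_zero fun hN0 => ?_
    obtain rfl : n = 0 := by omega
    have : lam0 + 1 ≤ lam0 := hlam0.2 fun x _ => by rwa [Subsingleton.elim x 0]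
    linarith
  have hγ_pos : 0 < γmax := by
    obtain ⟨r, hr, hball⟩ :=
      (convex_preN_zero (A := A) (B := B) (E := E) hSconv hDconv N).exists_closedBall_subset_of_absorbs
        fun x => exists_smul_mem_preN_zero hSconv hDconv h0int N x <| mem_preN_univ_zero N x <| by
          have : reachSpan A B E N = ⊤ := top_unique <| hctrb.ge.trans <| Submodule.span_mono <| by
            rintro v ⟨i, hi, h⟩
            exact ⟨i, hi.trans_le hN, h⟩
          simp [this]
    have hpos : 0 < rco + 1 := by linarith [hrco.1.1]
    refine (div_pos hr hpos).trans_le (hγmax.2 ?_)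
    rintro _ ⟨x, hx, rfl⟩
    refine hball ?_
    have := mem_closedBall_zero_iff.1 (hrco.1.2 hx)
    rw [mem_closedBall_zero_iff]
    change ‖(r / (rco + 1)) • x‖ ≤ r
    rw [norm_smul, Real.norm_of_nonneg (by positivity), div_mul_eq_mul_div, div_le_iff₀ hpos]
    nlinarith
  have hgeom : ∀ k : ℕ, (1 - (1 - lam0) * (1 - γmax) ^ k) • Cco ⊆ Prod.fst '' Cfam (p₀ + N * k) := by
    intro k
    induction k with
    | zero => simpa using hlam0.1
    | succ k ih =>
      have hpow0 : 0 ≤ (1 - γmax) ^ k := pow_nonneg (by linarith) k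
      have hpow1 : (1 - γmax) ^ k ≤ 1 := pow_le_one₀ (by linarith) (by linarith)
      rintro _ ⟨x, hx, rfl⟩
      rw [Nat.mul_succ, ← Nat.add_assoc]
      refine preN_fst_image_subset hCfam (p₀ + N * k) N ?_
      have := preN_dcDyn_add_smul hSconv hDconv
        (a := 1 - (1 - lam0) * (1 - γmax) ^ k) (b := (1 - lam0) * (1 - γmax) ^ k)
        (by nlinarith) (mul_nonneg (by linarith) hpow0) (by ring)
        (fun y hy z hz => by
          rw [mem_singleton_iff.1 hz, smul_zero, add_zero]
          exact ih (smul_mem_smul_set hy)) N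
        x (subset_preN_of_isCIS hCco.1 N hx) _ (hγmax.1 (smul_mem_smul_set hx))
      convert this using 1
      change (_ : ℝ) • x = _
      module
  have hbound : ∀ p : ℕ, p₀ ≤ p → Metric.hausdorffDist (Prod.fst '' (Cfam p)) Cco ≤
      (1 - lam0) * (1 - γmax) ^ ((p - p₀) / N) * rco := by
    intro p hp
    have hle : p₀ + N * ((p - p₀) / N) ≤ p := by
      have := Nat.mul_div_le (p - p₀) N
      omega
    have hnn : 0 ≤ (1 - lam0) * (1 - γmax) ^ ((p - p₀) / N) :=
      mul_nonneg (by linarith) (pow_nonneg (by linarith) _)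
    have := hausdorffDist_le_of_smul_subset (by linarith) hrco.1.1 hrco.1.2 (hproj p)
      ((hgeom ((p - p₀) / N)).trans (hmono hle))
    simpa using this
  refine ⟨?_, hbound⟩
  have hdiv : Filter.Tendsto (fun p : ℕ => (p - p₀) / N) Filter.atTop Filter.atTop :=
    (Nat.tendsto_div_const_atTop hN0.ne').comp (Filter.tendsto_sub_atTop_nat p₀)
  have hlim : Filter.Tendsto (fun p : ℕ => (1 - lam0) * (1 - γmax) ^ ((p - p₀) / N) * rco)
      Filter.atTop (nhds 0) := by
    simpa using (((tendsto_pow_atTop_nhds_zero_of_lt_one (by linarith) (by linarith)).comp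
      hdiv).const_mul (1 - lam0)).mul_const rco
  exact squeeze_zero' (Filter.Eventually.of_forall fun _ => Metric.hausdorffDist_nonneg)
    (Filter.eventually_atTop.2 ⟨p₀, hbound⟩) hlim
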